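/- Let n ≥ 2 and let G be a directed simple graph on V = Fin n with distinguished vertex 0. If G admits a nontrivial ear decomposition rooted at 0, then there exists A ∈ Θ_G such that B_G(A) (with distinguished vertex 0) has full column rank (n−1)·(n−2). -/

import Mathlib

open Matrix

attribute [local instance] Classical.propDecidable

variable {V : Type*}

/-- The parameter space `Θ_G` of a directed simple graph given by the edge
relation `E` (where `E j i` means there is an edge `j → i`): matrices whose
off-diagonal entry `(i,j)` vanishes unless `j → i` is an edge. -/
def Theta (E : V → V → Prop) : Set (Matrix V V ℂ) :=
  {A | ∀ i j, i ≠ j → ¬ E j i → A i j = 0}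

/-- The coefficient matrix `B_G(A)`: rows indexed by the non-edges
`(k,l)` (the zero positions of a generic element of `Θ_G`), columns indexed
by pairs `(i,j)` with `i ≠ j` avoiding the distinguished vertex `r`. -/
noncomputable def Bmat (E : V → V → Prop) (r : V) (A : Matrix V V ℂ) :
    Matrix {p : V × V // p.1 ≠ p.2 ∧ ¬ E p.2 p.1}
      {p : V × V // p.1 ≠ p.2 ∧ p.1 ≠ r ∧ p.2 ≠ r} ℂ :=
  fun kl ij =>
    if ij.1.1 = kl.1.1 ∧ ij.1.2 = kl.1.2 then A kl.1.1 kl.1.1 - A kl.1.2 kl.1.2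
    else if ij.1.1 = kl.1.1 then -A ij.1.2 kl.1.2
    else if ij.1.2 = kl.1.2 then A kl.1.1 ij.1.1
    else 0

/-- `B_G(A)` has full column rank `(|V|-1)(|V|-2)` for some `A ∈ Θ_G`. -/
def HasFullB [Fintype V] (E : V → V → Prop) (r : V) : Prop :=
  ∃ A ∈ Theta E, (Bmat E r A).rank = (Fintype.card V - 1) * (Fintype.card V - 2)
variable {V : Type*}

/-- The set of consecutive pairs of a list: the edges of the path it traces. -/
def chainPairs (L : List V) : Set (V × V) := {e | e ∈ L.zip L.tail}

/-- Adding a nontrivial ear: new distinct vertices `w₁, …, w_s` (`s ≥ 1`) outside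
the current vertex set, attached by the path `k → w₁ → ⋯ → w_s → l` with
`k, l` in the current vertex set, all of whose edges are edges of `G`. -/
def IsEarStep (E : V → V → Prop) (p q : Set V × Set (V × V)) : Prop :=
  ∃ (k l : V) (ws : List V), ws ≠ [] ∧ ws.Nodup ∧ k ∈ p.1 ∧ l ∈ p.1 ∧
    (∀ w ∈ ws, w ∉ p.1) ∧
    (∀ e ∈ chainPairs (k :: ws ++ [l]), E e.1 e.2) ∧
    q.1 = p.1 ∪ {x | x ∈ ws} ∧ q.2 = p.2 ∪ chainPairs (k :: ws ++ [l])

/-- Adding a trivial ear: a single new edge `k → l` of `G` between vertices of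
the current vertex set. -/
def IsTrivialEarStep (E : V → V → Prop) (p q : Set V × Set (V × V)) : Prop :=
  ∃ k l : V, k ∈ p.1 ∧ l ∈ p.1 ∧ E k l ∧ (k, l) ∉ p.2 ∧
    q.1 = p.1 ∧ q.2 = p.2 ∪ {(k, l)}

/-- A directed cycle of `G` through the vertex `r`, with at least two vertices,
recorded as a pair (vertex set, edge set). -/
def IsCycleAt (E : V → V → Prop) (r : V) (p : Set V × Set (V × V)) : Prop :=
  ∃ vs : List V, vs ≠ [] ∧ (r :: vs).Nodup ∧
    (∀ e ∈ chainPairs (r :: vs ++ [r]), E e.1 e.2) ∧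
    p.1 = {x | x ∈ r :: vs} ∧ p.2 = chainPairs (r :: vs ++ [r])

/-- A nontrivial ear decomposition of `G` rooted at `r`: a sequence of pairs
(vertex set, edge set), starting with a cycle through `r`, each obtained from
the previous one by adding a nontrivial ear, and ending with all of `G`. -/
def HasNontrivialEarDecomp (E : V → V → Prop) (r : V) : Prop :=
  ∃ (t : ℕ) (P : Fin (t + 1) → Set V × Set (V × V)),
    IsCycleAt E r (P 0) ∧
    (∀ i : Fin t, IsEarStep E (P i.castSucc) (P i.succ)) ∧
    (P (Fin.last t)).1 = Set.univ ∧ (P (Fin.last t)).2 = {e : V × V | E e.1 e.2}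

section Perturbation

open Filter

theorem eventually_injOn_add_smul {M N : Type*} [AddCommGroup M] [Module ℂ M]
    [FiniteDimensional ℂ M] [AddCommGroup N] [Module ℂ N] (p : Submodule ℂ M)
    (f g : M →ₗ[ℂ] N) (hf : ∀ x ∈ p, f x = 0 → x = 0) :
    ∀ᶠ β : ℂ in cofinite, ∀ x ∈ p, f x + β • g x = 0 → x = 0 := by
  have hker : LinearMap.ker (f.domRestrict p) = ⊥ := by
    rw [LinearMap.ker_eq_bot']
    rintro ⟨x, hx⟩ h
    exact Subtype.ext (hf x hx h)
  obtain ⟨L, hL⟩ := LinearMap.exists_leftInverse_of_injective _ hker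
  let e : Module.End ℂ p := L ∘ₗ g.domRestrict p
  have hfin : {μ : ℂ | Module.End.HasEigenvalue e μ}.Finite := Module.End.finite_hasEigenvalue e
  have hinj : Function.Injective fun β : ℂ => -β⁻¹ := fun a b h => by simpa using h
  rw [eventually_cofinite]
  refine (hfin.preimage hinj.injOn).subset ?_
  intro β hβ
  simp only [Set.mem_ofPred_eq, not_forall] at hβ
  obtain ⟨x, hx, h, hx0⟩ := hβ
  have hβ0 : β ≠ 0 := by
    rintro rfl
    exact hx0 (hf x hx (by simpa using h))
  have hLf : L (f x) = ⟨x, hx⟩ := LinearMap.congr_fun hL ⟨x, hx⟩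
  have key : (⟨x, hx⟩ : p) + β • e ⟨x, hx⟩ = 0 := by
    have := congrArg L h
    rw [map_add, map_smul, map_zero, hLf] at this
    exact this
  refine Module.End.hasEigenvalue_of_hasEigenvector (x := ⟨x, hx⟩) ⟨?_, ?_⟩
  · rw [Module.End.mem_eigenspace_iff]
    have : e ⟨x, hx⟩ = β⁻¹ • (β • e ⟨x, hx⟩) := by rw [smul_smul, inv_mul_cancel₀ hβ0, one_smul]
    rw [this, eq_neg_of_add_eq_zero_right key]
    simp
  · simpa using hx0

end Perturbation

section Observability

open Filter

variable [Fintype V]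

/-- The resolvent of `A` at `d` exists and its `(r, v)` entry does not vanish, expressed without
inverses. -/
def Observable (A : Matrix V V ℂ) (r v : V) (d : ℂ) : Prop :=
  ∀ (y : V → ℂ) (η : ℂ), A *ᵥ y = d • y + η • Pi.single v 1 → y r = 0 → y = 0

theorem Observable.coeff_eq_zero {A : Matrix V V ℂ} {r v : V} {d : ℂ} (h : Observable A r v d)
    {y : V → ℂ} {η : ℂ} (hy : A *ᵥ y = d • y + η • Pi.single v 1) (hr : y r = 0) : η = 0 := by
  have h0 := h y η hy hr
  subst h0
  simpa using (congrFun hy v).symm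

theorem Observable.eventually_add_smul {A : Matrix V V ℂ} {r v : V} {d : ℂ}
    (h : Observable A r v d) (B : Matrix V V ℂ) :
    ∀ᶠ β : ℂ in cofinite, Observable (A + β • B) r v d := by
  let p : Submodule ℂ ((V → ℂ) × ℂ) :=
    LinearMap.ker (LinearMap.proj r ∘ₗ LinearMap.fst ℂ (V → ℂ) ℂ)
  let f : (V → ℂ) × ℂ →ₗ[ℂ] (V → ℂ) :=
    (A.mulVecLin - d • LinearMap.id) ∘ₗ LinearMap.fst ℂ (V → ℂ) ℂ -
      (LinearMap.toSpanSingleton ℂ (V → ℂ) (Pi.single v 1)) ∘ₗ LinearMap.snd ℂ (V → ℂ) ℂ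
  let g : (V → ℂ) × ℂ →ₗ[ℂ] (V → ℂ) := B.mulVecLin ∘ₗ LinearMap.fst ℂ (V → ℂ) ℂ
  have hf : ∀ x ∈ p, f x = 0 → x = 0 := by
    rintro ⟨y, η⟩ hr hx
    have hr' : y r = 0 := hr
    have hx' : A *ᵥ y = d • y + η • Pi.single v 1 := by
      have : A *ᵥ y - d • y - η • Pi.single v 1 = 0 := hx
      rw [← sub_eq_zero, ← this]; abel
    exact Prod.ext (h y η hx' hr') (h.coeff_eq_zero hx' hr')
  filter_upwards [eventually_injOn_add_smul p f g hf] with β hβ y η hy hr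
  refine congrArg Prod.fst (hβ (y, η) hr ?_)
  change A *ᵥ y - d • y - η • Pi.single v 1 + β • B *ᵥ y = 0
  rw [Matrix.add_mulVec, Matrix.smul_mulVec] at hy
  rw [← sub_eq_zero.2 hy]; abel

theorem Observable.eventually {A : Matrix V V ℂ} {r v : V} {d : ℂ} (h : Observable A r v d) :
    ∀ᶠ d' : ℂ in cofinite, Observable A r v d' := by
  have h1 := (sub_left_injective (b := d)).tendsto_cofinite.eventually
    (h.eventually_add_smul (-1))
  filter_upwards [h1] with d' hd y η hy hr
  refine hd y η ?_ hr
  rw [Matrix.add_mulVec, Matrix.smul_mulVec, Matrix.neg_mulVec, Matrix.one_mulVec, hy]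
  module

theorem Observable.of_mulVec_single {A : Matrix V V ℂ} {r u w : V} {a c d : ℂ}
    (h : Observable A r u d) (hc : c ≠ 0) (hw : w ≠ r)
    (hA : A *ᵥ Pi.single w 1 = a • Pi.single w 1 + c • Pi.single u 1) : Observable A r w d := by
  intro y η hy hr
  have h1 : A *ᵥ (A *ᵥ y - a • y) = d • (A *ᵥ y - a • y) + (η * c) • Pi.single u 1 := by
    have : A *ᵥ (A *ᵥ y) = d • (A *ᵥ y) + η • (a • Pi.single w 1 + c • Pi.single u 1) := by
      conv_lhs => rw [hy]
      rw [Matrix.mulVec_add, Matrix.mulVec_smul, Matrix.mulVec_smul, hA]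
    rw [Matrix.mulVec_sub, this, Matrix.mulVec_smul, hy]
    module
  have h2 : (A *ᵥ y - a • y) r = 0 := by
    rw [hy]
    simp [hr, hw.symm]
  have h3 : η = 0 := (mul_eq_zero.1 (h.coeff_eq_zero h1 h2)).resolve_right hc
  refine h y 0 ?_ hr
  rw [hy, h3]
  simp

end Observability

section Ear

/-- The sequence `W 0 → W 1 → ⋯ → W (m + 2)` has its endpoints in `S` and its interior vertices
pairwise distinct and outside `S`. -/
structure IsEarPath (S : Set V) (W : ℕ → V) (m : ℕ) : Prop where
  start_mem : W 0 ∈ S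
  end_mem : W (m + 2) ∈ S
  notMem : ∀ q ≤ m, W (q + 1) ∉ S
  inj : ∀ p ≤ m, ∀ q ≤ m, W (p + 1) = W (q + 1) → p = q

/-- The edges of the sequence `W 0 → W 1 → ⋯ → W (m + 2)`. -/
def earEdges (W : ℕ → V) (m : ℕ) : Set (V × V) := {e | ∃ q ≤ m + 1, e = (W q, W (q + 1))}

/-- The interior vertices of the sequence `W 0 → W 1 → ⋯ → W (m + 2)`. -/
def earInterior (W : ℕ → V) (m : ℕ) : Set V := {x | ∃ q ≤ m, x = W (q + 1)}

namespace IsEarPath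

variable {S : Set V} {W : ℕ → V} {m : ℕ}

theorem eq_iff (h : IsEarPath S W m) {p q : ℕ} (hp : p ≤ m) (hq : q ≤ m) :
    W (p + 1) = W (q + 1) ↔ p = q :=
  ⟨h.inj p hp q hq, fun e => by rw [e]⟩

theorem ne_of_mem (h : IsEarPath S W m) {q : ℕ} (hq : q ≤ m) {v : V} (hv : v ∈ S) :
    v ≠ W (q + 1) := fun e => h.notMem q hq (e ▸ hv)

theorem eq_iff' (h : IsEarPath S W m) {p q : ℕ} (hp : p ≤ m) (hq : q ≤ m) :
    W p = W (q + 1) ↔ p = q + 1 := by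
  cases p with
  | zero => simpa using h.ne_of_mem hq h.start_mem
  | succ p => rw [h.eq_iff (by omega) hq]; omega

theorem eq_old_iff (h : IsEarPath S W m) {p : ℕ} (hp : p ≤ m + 1) {v : V} (hv : v ∈ S) :
    W p = v ↔ p = 0 ∧ W 0 = v := by
  cases p with
  | zero => simp
  | succ p => simpa using (h.ne_of_mem (by omega) hv).symm

theorem edge_new_new (h : IsEarPath S W m) {i j : ℕ} (hi : i ≤ m) (hj : j ≤ m)
    (he : (W (j + 1), W (i + 1)) ∈ earEdges W m) : i = j + 1 := by
  obtain ⟨q, hq, he⟩ := he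
  rw [Prod.mk.injEq] at he
  rcases q with _ | q
  · exact absurd he.1.symm (h.ne_of_mem hj h.start_mem)
  · have h1 := h.inj _ hj _ (by omega) he.1
    subst h1
    rcases Nat.lt_or_ge j m with hjm | hjm
    · exact h.inj _ hi _ (by omega) he.2
    · obtain rfl : j = m := by omega
      exact absurd he.2.symm (h.ne_of_mem hi h.end_mem)

theorem edge_new_old (h : IsEarPath S W m) {j : ℕ} (hj : j ≤ m) {v : V} (hv : v ∈ S)
    (he : (W (j + 1), v) ∈ earEdges W m) : j = m ∧ v = W (m + 2) := by
  obtain ⟨q, hq, he⟩ := he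
  rw [Prod.mk.injEq] at he
  rcases Nat.lt_or_ge m q with hqm | hqm
  · obtain rfl : q = m + 1 := by omega
    exact ⟨h.inj _ hj _ le_rfl he.1, he.2⟩
  · exact absurd he.2 (h.ne_of_mem hqm hv)

theorem edge_old_new (h : IsEarPath S W m) {i : ℕ} (hi : i ≤ m) {v : V} (hv : v ∈ S)
    (he : (v, W (i + 1)) ∈ earEdges W m) : i = 0 ∧ v = W 0 := by
  obtain ⟨q, hq, he⟩ := he
  rw [Prod.mk.injEq] at he
  rcases q with _ | q
  · exact ⟨h.inj _ hi _ (by omega) he.2, he.1⟩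
  · exact absurd he.1 (h.ne_of_mem (by omega) hv)

theorem edge_old_old (h : IsEarPath S W m) {u v : V} (hu : u ∈ S) (hv : v ∈ S) :
    (u, v) ∉ earEdges W m := by
  rintro ⟨q, hq, he⟩
  rw [Prod.mk.injEq] at he
  rcases q with _ | q
  · exact h.ne_of_mem (Nat.zero_le m) hv he.2
  · exact h.ne_of_mem (by omega) hu he.1

theorem mem_union (h : IsEarPath S W m) {q : ℕ} (hq : q ≤ m + 2) :
    W q ∈ S ∪ earInterior W m := by
  rcases q with _ | q
  · exact Or.inl h.start_mem
  · rcases Nat.lt_or_ge m q with hqm | hqm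
    · obtain rfl : q = m + 1 := by omega
      exact Or.inl h.end_mem
    · exact Or.inr ⟨q, hqm, rfl⟩

end IsEarPath

/-- The matrix `A` enlarged by the diagonal entries `d q` at the interior vertices `W (q + 1)`
and by a weight `1` on every edge of the path except the last one. -/
noncomputable def earMatrix (A : Matrix V V ℂ) (W : ℕ → V) (m : ℕ) (d : ℕ → ℂ) : Matrix V V ℂ :=
  A + ∑ q ∈ Finset.range (m + 1),
    (Matrix.single (W (q + 1)) (W (q + 1)) (d q) + Matrix.single (W (q + 1)) (W q) 1)

section

variable {S : Set V} {W : ℕ → V} {m : ℕ} {A : Matrix V V ℂ} {d : ℕ → ℂ}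

theorem earMatrix_apply (i j : V) : earMatrix A W m d i j = A i j +
    ∑ q ∈ Finset.range (m + 1), ((if W (q + 1) = i ∧ W (q + 1) = j then d q else 0) +
      if W (q + 1) = i ∧ W q = j then 1 else 0) := by
  simp [earMatrix, Matrix.sum_apply, Matrix.single_apply]

theorem earMatrix_row_old (h : IsEarPath S W m) {i : V} (hi : i ∈ S) (v : V) :
    earMatrix A W m d i v = A i v := by
  rw [earMatrix_apply, Finset.sum_eq_zero, add_zero]
  intro q hq
  have := (h.ne_of_mem (Finset.mem_range_succ_iff.1 hq) hi).symm
  simp [this]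

theorem earMatrix_row_new (h : IsEarPath S W m) (hA : ∀ i j, A i j ≠ 0 → i ∈ S ∧ j ∈ S) {p : ℕ}
    (hp : p ≤ m) (v : V) : earMatrix A W m d (W (p + 1)) v =
      (if v = W (p + 1) then d p else 0) + if v = W p then 1 else 0 := by
  have h0 : A (W (p + 1)) v = 0 := by
    by_contra hne
    exact h.notMem p hp (hA _ _ hne).1
  rw [earMatrix_apply, Finset.sum_eq_single_of_mem p (Finset.mem_range_succ_iff.2 hp), h0]
  · simp [eq_comm]
  · intro q hq hqp
    simp [h.eq_iff (Finset.mem_range_succ_iff.1 hq) hp, hqp]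

theorem earMatrix_col_old (h : IsEarPath S W m) {j : V} (hj : j ∈ S) (v : V) :
    earMatrix A W m d v j = A v j + if v = W 1 ∧ j = W 0 then 1 else 0 := by
  rw [earMatrix_apply, Finset.sum_eq_single_of_mem 0 (by simp)]
  · have := (h.ne_of_mem (Nat.zero_le m) hj).symm
    simp only [zero_add] at this
    simp [this, eq_comm]
  · intro q hq hqp
    have hq := Finset.mem_range_succ_iff.1 hq
    have := (h.ne_of_mem hq hj).symm
    simp [this, h.eq_old_iff (by omega : q ≤ m + 1) hj, hqp]

theorem earMatrix_col_new (h : IsEarPath S W m) (hA : ∀ i j, A i j ≠ 0 → i ∈ S ∧ j ∈ S) {p : ℕ}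
    (hp : p ≤ m) (v : V) : earMatrix A W m d v (W (p + 1)) =
      (if v = W (p + 1) then d p else 0) + if p < m ∧ v = W (p + 2) then 1 else 0 := by
  have h0 : A v (W (p + 1)) = 0 := by
    by_contra hne
    exact h.notMem p hp (hA _ _ hne).2
  rw [earMatrix_apply, Finset.sum_add_distrib, h0, zero_add]
  congr 1
  · rw [Finset.sum_eq_single_of_mem p (Finset.mem_range_succ_iff.2 hp)]
    · simp [eq_comm]
    · intro q hq hqp
      simp [h.eq_iff (Finset.mem_range_succ_iff.1 hq) hp, hqp]
  · by_cases hpm : p < m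
    · rw [Finset.sum_eq_single_of_mem (p + 1) (Finset.mem_range_succ_iff.2 hpm)]
      · simp [eq_comm, hpm]
      · intro q hq hqp
        simp [h.eq_iff' (Finset.mem_range_succ_iff.1 hq) hp, hqp]
    · rw [Finset.sum_eq_zero]
      · simp [hpm]
      · intro q hq
        have hq := Finset.mem_range_succ_iff.1 hq
        have : q ≠ p + 1 := by omega
        simp [h.eq_iff' hq hp, this]

theorem earMatrix_ne_zero {i j : V} (hij : earMatrix A W m d i j ≠ 0) :
    A i j ≠ 0 ∨ i ∈ earInterior W m ∧ i = j ∨ ∃ q ≤ m, i = W (q + 1) ∧ j = W q := by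
  contrapose! hij
  obtain ⟨h0, h1, h2⟩ := hij
  rw [earMatrix_apply, h0, zero_add]
  refine Finset.sum_eq_zero fun q hq => ?_
  have hq := Finset.mem_range_succ_iff.1 hq
  rw [if_neg, if_neg, add_zero]
  · exact fun hh => h2 q hq hh.1.symm hh.2.symm
  · exact fun hh => h1 ⟨q, hq, hh.1.symm⟩ (hh.1.symm.trans hh.2)

end

/-- The entries of `X` at the positions satisfying `P`, and zeros elsewhere. -/
noncomputable def entryMask (P : V → V → Prop) : Matrix V V ℂ →ₗ[ℂ] Matrix V V ℂ where
  toFun X := Matrix.of fun i j => if P i j then X i j else 0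
  map_add' X Y := by
    ext i j
    by_cases h : P i j <;> simp [h]
  map_smul' c X := by
    ext i j
    by_cases h : P i j <;> simp [h]

theorem entryMask_of_pos {P : V → V → Prop} {i j : V} (h : P i j) (X : Matrix V V ℂ) :
    entryMask P X i j = X i j := if_pos h

theorem entryMask_of_neg {P : V → V → Prop} {i j : V} (h : ¬ P i j) (X : Matrix V V ℂ) :
    entryMask P X i j = 0 := if_neg h

variable [Fintype V]

theorem earMatrix_row_new_sum {S : Set V} {W : ℕ → V} {m : ℕ} {A : Matrix V V ℂ} {d : ℕ → ℂ}
    (h : IsEarPath S W m) (hA : ∀ i j, A i j ≠ 0 → i ∈ S ∧ j ∈ S) {p : ℕ} (hp : p ≤ m)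
    (f : V → ℂ) :
    ∑ u, earMatrix A W m d (W (p + 1)) u * f u = d p * f (W (p + 1)) + f (W p) := by
  simp [earMatrix_row_new h hA hp, add_mul, Finset.sum_add_distrib]

theorem earMatrix_col_new_sum {S : Set V} {W : ℕ → V} {m : ℕ} {A : Matrix V V ℂ} {d : ℕ → ℂ}
    (h : IsEarPath S W m) (hA : ∀ i j, A i j ≠ 0 → i ∈ S ∧ j ∈ S) {p : ℕ} (hp : p ≤ m)
    (f : V → ℂ) : ∑ u, f u * earMatrix A W m d u (W (p + 1)) =
      f (W (p + 1)) * d p + if p < m then f (W (p + 2)) else 0 := by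
  by_cases hpm : p < m <;>
    simp [earMatrix_col_new h hA hp, mul_add, Finset.sum_add_distrib, hpm]

theorem Observable.earMatrix {S : Set V} {W : ℕ → V} {m : ℕ} {A : Matrix V V ℂ} {d : ℕ → ℂ}
    {r v : V} {e : ℂ} (hobs : Observable A r v e) (h : IsEarPath S W m)
    (hA : ∀ i j, A i j ≠ 0 → i ∈ S ∧ j ∈ S) (hv : v ∈ S)
    (he : ∀ q ≤ m, d q ≠ e) (he0 : e ≠ 0) : Observable (earMatrix A W m d) r v e := by
  intro y η hy hyr
  have hpt : ∀ i, ∑ u, _root_.earMatrix A W m d i u * y u =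
      e * y i + η * (Pi.single v 1 : V → ℂ) i := fun i => congrFun hy i
  have hS : S.indicator y = 0 := by
    refine hobs _ η ?_ (by simp [hyr])
    ext i
    change ∑ u, A i u * S.indicator y u = e * S.indicator y i + η * (Pi.single v 1 : V → ℂ) i
    by_cases hi : i ∈ S
    · rw [Set.indicator_of_mem hi, ← hpt i]
      refine Finset.sum_congr rfl fun u _ => ?_
      rw [earMatrix_row_old h hi]
      by_cases hu : u ∈ S
      · rw [Set.indicator_of_mem hu]
      · have : A i u = 0 := by
          by_contra hne
          exact hu (hA _ _ hne).2
        simp [this]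
    · have hiv : i ≠ v := fun hh => hi (hh ▸ hv)
      rw [Set.indicator_of_notMem hi, Finset.sum_eq_zero]
      · simp [hiv]
      · intro u _
        have : A i u = 0 := by
          by_contra hne
          exact hi (hA _ _ hne).1
        simp [this]
  have hyS : ∀ i ∈ S, y i = 0 := fun i hi => by
    simpa [Set.indicator_of_mem hi] using congrFun hS i
  have hyW : ∀ p ≤ m + 1, y (W p) = 0 := by
    intro p
    induction p with
    | zero => exact fun _ => hyS _ h.start_mem
    | succ p ih =>
      intro hp
      have hpm : p ≤ m := by omega
      have h1 := hpt (W (p + 1))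
      have hne : W (p + 1) ≠ v := (h.ne_of_mem hpm hv).symm
      rw [earMatrix_row_new_sum h hA hpm, ih (by omega), Pi.single_eq_of_ne hne] at h1
      exact (mul_eq_zero.1 (by linear_combination h1 : (d p - e) * y (W (p + 1)) = 0)).resolve_left
        (sub_ne_zero.2 (he p hpm))
  ext i
  by_cases hi : i ∈ S
  · exact hyS i hi
  have hiv : i ≠ v := fun hh => hi (hh ▸ hv)
  by_cases hiW : ∃ q ≤ m, i = W (q + 1)
  · obtain ⟨q, hq, rfl⟩ := hiW
    exact hyW _ (by omega)
  have h1 := hpt i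
  rw [Finset.sum_eq_zero, Pi.single_eq_of_ne hiv] at h1
  · simpa [he0] using h1
  intro u _
  rw [mul_eq_zero]
  refine Or.inl (by_contra fun hne => ?_)
  rcases earMatrix_ne_zero hne with h2 | h2 | ⟨q, hq, h2, -⟩
  · exact hi (hA _ _ h2).1
  · exact hiW h2.1
  · exact hiW ⟨q, hq, h2⟩

theorem Observable.earMatrix_transpose {S : Set V} {W : ℕ → V} {m : ℕ} {A : Matrix V V ℂ}
    {d : ℕ → ℂ} {r v : V} {e : ℂ} (hobs : Observable Aᵀ r v e) (h : IsEarPath S W m)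
    (hA : ∀ i j, A i j ≠ 0 → i ∈ S ∧ j ∈ S) (hv : v ∈ S)
    (he : ∀ q ≤ m, d q ≠ e) (he0 : e ≠ 0) : Observable (_root_.earMatrix A W m d)ᵀ r v e := by
  intro y η hy hyr
  have hpt : ∀ i, ∑ u, _root_.earMatrix A W m d u i * y u =
      e * y i + η * (Pi.single v 1 : V → ℂ) i := fun i => congrFun hy i
  have hyW : ∀ k p, p + k = m → y (W (p + 1)) = 0 := by
    intro k
    induction k with
    | zero =>
      intro p hp
      obtain rfl : p = m := by omega
      have h1 := hpt (W (p + 1))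
      have hne : W (p + 1) ≠ v := (h.ne_of_mem le_rfl hv).symm
      simp only [mul_comm _ (y _)] at h1
      rw [earMatrix_col_new_sum h hA le_rfl, if_neg (lt_irrefl p), Pi.single_eq_of_ne hne] at h1
      exact (mul_eq_zero.1 (by linear_combination h1 : (d p - e) * y (W (p + 1)) = 0)).resolve_left
        (sub_ne_zero.2 (he p le_rfl))
    | succ k ih =>
      intro p hp
      have hpm : p < m := by omega
      have h1 := hpt (W (p + 1))
      have hne : W (p + 1) ≠ v := (h.ne_of_mem hpm.le hv).symm
      simp only [mul_comm _ (y _)] at h1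
      rw [earMatrix_col_new_sum h hA hpm.le, if_pos hpm, ih (p + 1) (by omega),
        Pi.single_eq_of_ne hne] at h1
      exact (mul_eq_zero.1 (by linear_combination h1 : (d p - e) * y (W (p + 1)) = 0)).resolve_left
        (sub_ne_zero.2 (he p hpm.le))
  have hyW1 : y (W 1) = 0 := hyW m 0 (by omega)
  have hS : S.indicator y = 0 := by
    refine hobs _ η ?_ (by simp [hyr])
    ext i
    change ∑ u, A u i * S.indicator y u = e * S.indicator y i + η * (Pi.single v 1 : V → ℂ) i
    by_cases hi : i ∈ S
    · rw [Set.indicator_of_mem hi, ← hpt i]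
      refine Finset.sum_congr rfl fun u _ => ?_
      rw [earMatrix_col_old h hi]
      have h1 : (if u = W 1 ∧ i = W 0 then (1 : ℂ) else 0) * y u = 0 := by
        split_ifs with hc
        · rw [hc.1, hyW1, mul_zero]
        · rw [zero_mul]
      rw [add_mul, h1, add_zero]
      by_cases hu : u ∈ S
      · rw [Set.indicator_of_mem hu]
      · have : A u i = 0 := by
          by_contra hne
          exact hu (hA _ _ hne).1
        simp [this]
    · have hiv : i ≠ v := fun hh => hi (hh ▸ hv)
      rw [Set.indicator_of_notMem hi, Finset.sum_eq_zero]
      · simp [hiv]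
      · intro u _
        have : A u i = 0 := by
          by_contra hne
          exact hi (hA _ _ hne).2
        simp [this]
  ext i
  by_cases hi : i ∈ S
  · simpa [Set.indicator_of_mem hi] using congrFun hS i
  have hiv : i ≠ v := fun hh => hi (hh ▸ hv)
  by_cases hiW : ∃ q ≤ m, i = W (q + 1)
  · obtain ⟨q, hq, rfl⟩ := hiW
    exact hyW (m - q) q (by omega)
  have h1 := hpt i
  rw [Finset.sum_eq_zero, Pi.single_eq_of_ne hiv] at h1
  · simpa [he0] using h1
  intro u _
  rw [mul_eq_zero]
  refine Or.inl (by_contra fun hne => ?_)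
  rcases earMatrix_ne_zero hne with h2 | ⟨h2, rfl⟩ | ⟨q, hq, -, h2⟩
  · exact hi (hA _ _ h2).2
  · exact hiW h2
  · rcases q with _ | q
    · exact hi (h2 ▸ h.start_mem)
    · exact hiW ⟨q, by omega, h2⟩

theorem path_commutator_eq_zero {m : ℕ} {d : ℕ → ℂ} (hd : Function.Injective d) {U : ℕ → ℕ → ℂ}
    (hdiag : ∀ i ≤ m, U i i = 0) (hlast : ∀ j ≤ m, U m j = 0)
    (hrel : ∀ i ≤ m, ∀ j ≤ m, i ≠ j → i ≠ j + 1 →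
      d i * U i j + (if i = 0 then 0 else U (i - 1) j) =
        U i j * d j + if j < m then U i (j + 1) else 0) :
    ∀ i ≤ m, ∀ j ≤ m, U i j = 0 := by
  have hlow : ∀ k i j, i + k = m → j < i → U i j = 0 := by
    intro k
    induction k with
    | zero => exact fun i j hi hj => by rw [show i = m by omega]; exact hlast j (by omega)
    | succ k ih =>
      intro i j hi hj
      have h1 := hrel (i + 1) (by omega) j (by omega) (by omega) (by omega)
      simpa [ih (i + 1) j (by omega) (by omega),
        ih (i + 1) (j + 1) (by omega) (by omega)] using h1
  have hup : ∀ k i j, i < j → j ≤ m → i + (m - j) = k → U i j = 0 := by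
    intro k
    induction k using Nat.strong_induction_on with
    | _ k ih =>
      intro i j hij hj hk
      have h1 := hrel i (by omega) j hj (by omega) (by omega)
      have h2 : (if i = 0 then 0 else U (i - 1) j) = 0 := by
        split_ifs with h0
        · rfl
        · exact ih (i - 1 + (m - j)) (by omega) _ _ (by omega) hj rfl
      have h3 : (if j < m then U i (j + 1) else 0) = 0 := by
        split_ifs with h0
        · exact ih (i + (m - (j + 1))) (by omega) _ _ (by omega) (by omega) rfl
        · rfl
      rw [h2, h3] at h1
      refine (mul_eq_zero.1 (by linear_combination h1 : (d i - d j) * U i j = 0)).resolve_left ?_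
      exact sub_ne_zero.2 (hd.ne hij.ne)
  intro i hi j hj
  rcases lt_trichotomy i j with hij | rfl | hij
  · exact hup _ i j hij hj rfl
  · exact hdiag i hi
  · exact hlow (m - i) i j (by omega) hij

/-- `A` is supported on the graph `(S, F)`, and the only matrix `X` supported on `S`, with vanishing
diagonal and vanishing row and column `r`, whose commutator with `A` vanishes at every non-edge of
`(S, F)` is `X = 0`. Moreover every vertex of `S` is joined to and from `r` by generically
nonvanishing entries of the resolvent of `A`. -/
structure IsRigidOn (S : Set V) (F : Set (V × V)) (r : V) (A : Matrix V V ℂ) : Prop where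
  root_mem : r ∈ S
  edge_mem : ∀ u v, (u, v) ∈ F → u ∈ S ∧ v ∈ S
  support : ∀ i j, A i j ≠ 0 → i ∈ S ∧ j ∈ S ∧ (i = j ∨ (j, i) ∈ F)
  eq_zero : ∀ X : Matrix V V ℂ,
    (∀ i j, X i j ≠ 0 → i ∈ S ∧ j ∈ S ∧ i ≠ j ∧ i ≠ r ∧ j ≠ r) →
    (∀ i ∈ S, ∀ j ∈ S, i ≠ j → (j, i) ∉ F → (A * X - X * A) i j = 0) → X = 0
  obs : ∀ v ∈ S, ∃ d, Observable A r v d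
  obs_transpose : ∀ v ∈ S, ∃ d, Observable Aᵀ r v d

theorem IsRigidOn.ear_limit {S : Set V} {F : Set (V × V)} {r : V} {A : Matrix V V ℂ}
    (hA : IsRigidOn S F r A) {W : ℕ → V} {m : ℕ} (h : IsEarPath S W m) {d : ℕ → ℂ}
    (hd : Function.Injective d) (hobs : ∀ q, Observable A r (W (m + 2)) (d q))
    (hobs' : ∀ q, Observable Aᵀ r (W 0) (d q)) {X Y Z : Matrix V V ℂ}
    (hY : Y = entryMask (fun i j => ¬ (i ∈ S ∧ j ∉ S)) X)
    (hZ : Z = entryMask (fun i j => i ∈ S ∧ j ∉ S) X)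
    (hX : ∀ i j, X i j ≠ 0 →
      i ∈ S ∪ earInterior W m ∧ j ∈ S ∪ earInterior W m ∧ i ≠ j ∧ i ≠ r ∧ j ≠ r)
    (hXY : ∀ i ∈ S ∪ earInterior W m, ∀ j ∈ S ∪ earInterior W m, i ≠ j →
      (j, i) ∉ F ∪ earEdges W m → ¬ (i ∈ S ∧ j ∉ S) →
      (earMatrix A W m d * Y - Y * earMatrix A W m d) i j = 0)
    (hXZ : ∀ i ∈ S, ∀ j ∈ earInterior W m, (j, i) ∉ earEdges W m →
      (Matrix.single (W (m + 2)) (W (m + 1)) (1 : ℂ) * Y -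
          Y * Matrix.single (W (m + 2)) (W (m + 1)) (1 : ℂ) +
        (earMatrix A W m d * Z - Z * earMatrix A W m d)) i j = 0) : X = 0 := by
  have hAS : ∀ i j, A i j ≠ 0 → i ∈ S ∧ j ∈ S := fun i j hij =>
    ⟨(hA.support i j hij).1, (hA.support i j hij).2.1⟩
  have hA0 : ∀ i j, i ∉ S ∨ j ∉ S → A i j = 0 := fun i j hij => by
    by_contra hne
    have := hAS i j hne
    tauto
  have hdiag : ∀ i, X i i = 0 := fun i => by_contra fun hne => (hX i i hne).2.2.1 rfl
  have hrow : ∀ j, X r j = 0 := fun j => by_contra fun hne => (hX r j hne).2.2.2.1 rfl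
  have hcol : ∀ i, X i r = 0 := fun i => by_contra fun hne => (hX i r hne).2.2.2.2 rfl
  have hYne : ∀ i j, i ∉ S ∨ j ∈ S → Y i j = X i j := fun i j hij => by
    rw [hY]; exact entryMask_of_pos (by tauto) X
  have hY0 : ∀ i j, i ∈ S → j ∉ S → Y i j = 0 := fun i j hi hj => by
    rw [hY]; exact entryMask_of_neg (by tauto) X
  have hZ1 : ∀ i j, i ∈ S → j ∉ S → Z i j = X i j := fun i j hi hj => by
    rw [hZ]; exact entryMask_of_pos ⟨hi, hj⟩ X
  have hZ0 : ∀ i j, i ∉ S ∨ j ∈ S → Z i j = 0 := fun i j hij => by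
    rw [hZ]; exact entryMask_of_neg (by tauto) X
  have hint : ∀ q ≤ m, W (q + 1) ∈ S ∪ earInterior W m := fun q hq => Or.inr ⟨q, hq, rfl⟩
  -- the block `S × S`
  have hSS : ∀ i ∈ S, ∀ j ∈ S, X i j = 0 := by
    obtain ⟨X', hX'⟩ : ∃ X', X' = entryMask (fun i j => i ∈ S ∧ j ∈ S) X := ⟨_, rfl⟩
    have hX'1 : ∀ i ∈ S, ∀ j ∈ S, X' i j = X i j := fun i hi j hj => by
      rw [hX']; exact entryMask_of_pos ⟨hi, hj⟩ X
    have hX'0 : ∀ i j, ¬ (i ∈ S ∧ j ∈ S) → X' i j = 0 := fun i j hij => by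
      rw [hX']; exact entryMask_of_neg (P := fun i j => i ∈ S ∧ j ∈ S) hij X
    have h0 : X' = 0 := by
      refine hA.eq_zero _ (fun i j hij => ?_) (fun i hi j hj hij hF => ?_)
      · have hc : i ∈ S ∧ j ∈ S := by_contra fun hc => hij (hX'0 i j hc)
        rw [hX'1 i hc.1 j hc.2] at hij
        exact ⟨hc.1, hc.2, (hX i j hij).2.2⟩
      · have hE : (j, i) ∉ F ∪ earEdges W m := fun hh => hh.elim hF (h.edge_old_old hj hi)
        rw [← hXY i (Or.inl hi) j (Or.inl hj) hij hE (by tauto), Matrix.sub_apply,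
          Matrix.sub_apply, Matrix.mul_apply, Matrix.mul_apply, Matrix.mul_apply, Matrix.mul_apply]
        congr 1
        · refine Finset.sum_congr rfl fun v _ => ?_
          rw [earMatrix_row_old h hi]
          by_cases hv : v ∈ S
          · rw [hX'1 _ hv _ hj, hYne _ _ (Or.inr hj)]
          · rw [hA0 _ _ (Or.inr hv), zero_mul, zero_mul]
        · refine Finset.sum_congr rfl fun v _ => ?_
          by_cases hv : v ∈ S
          · rw [hX'1 _ hi _ hv, hYne _ _ (Or.inr hv), earMatrix_row_old h hv]
          · rw [hY0 _ _ hi hv, hX'0 _ _ (by tauto), zero_mul, zero_mul]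
    intro i hi j hj
    rw [← hX'1 i hi j hj, h0, Matrix.zero_apply]
  -- the block `S × W` and the last row of the block `W × W`
  have hSWrel : ∀ q ≤ m, ∀ i ∈ S, q < m ∨ i ≠ W (m + 2) →
      (if i = W (m + 2) then X (W (m + 1)) (W (q + 1)) else 0) +
        (A *ᵥ fun v => Z v (W (q + 1))) i =
      d q * Z i (W (q + 1)) + if q < m then Z i (W (q + 2)) else 0 := by
    intro q hq i hi hqi
    have h1 := hXZ i hi _ ⟨q, hq, rfl⟩ fun hE => by
      obtain ⟨h2, h3⟩ := h.edge_new_old hq hi hE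
      exact hqi.elim (fun h4 => h4.ne h2) (fun h4 => h4 h3)
    have hB1 : (Matrix.single (W (m + 2)) (W (m + 1)) (1 : ℂ) * Y) i (W (q + 1)) =
        if i = W (m + 2) then X (W (m + 1)) (W (q + 1)) else 0 := by
      split_ifs with hil
      · rw [hil, Matrix.single_mul_apply_same, one_mul, hYne _ _ (Or.inl (h.notMem m le_rfl))]
      · rw [Matrix.single_mul_apply_of_ne _ _ _ _ _ hil]
    have hB2 : (Y * Matrix.single (W (m + 2)) (W (m + 1)) (1 : ℂ)) i (W (q + 1)) = 0 := by
      by_cases hqm : W (q + 1) = W (m + 1)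
      · rw [hqm, Matrix.mul_single_apply_same, hYne _ _ (Or.inr h.end_mem),
          hSS _ hi _ h.end_mem, zero_mul]
      · rw [Matrix.mul_single_apply_of_ne _ _ _ _ _ hqm]
    have hN1 : (earMatrix A W m d * Z) i (W (q + 1)) = (A *ᵥ fun v => Z v (W (q + 1))) i := by
      rw [Matrix.mul_apply]
      exact Finset.sum_congr rfl fun v _ => by rw [earMatrix_row_old h hi]
    rw [Matrix.add_apply, Matrix.sub_apply, Matrix.sub_apply, hB1, hB2, hN1, Matrix.mul_apply,
      earMatrix_col_new_sum h hAS hq] at h1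
    linear_combination h1
  have hSWstep : ∀ q ≤ m, (q < m → ∀ i, Z i (W (q + 2)) = 0) →
      (∀ i, Z i (W (q + 1)) = 0) ∧ (q < m → X (W (m + 1)) (W (q + 1)) = 0) := by
    intro q hq hnext
    have hite : ∀ i, (if q < m then Z i (W (q + 2)) else 0) = 0 := fun i => by
      split_ifs with hqm
      · exact hnext hqm i
      · rfl
    have hy : (fun v => Z v (W (q + 1))) = 0 := by
      refine hobs q _ ((A *ᵥ fun v => Z v (W (q + 1))) (W (m + 2)) -
        d q * Z (W (m + 2)) (W (q + 1))) ?_ ?_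
      · ext i
        simp only [Pi.add_apply, Pi.smul_apply, smul_eq_mul]
        by_cases hil : i = W (m + 2)
        · rw [hil, Pi.single_eq_same]
          ring
        · rw [Pi.single_eq_of_ne hil, mul_zero, add_zero]
          by_cases hi : i ∈ S
          · have h1 := hSWrel q hq i hi (Or.inr hil)
            rwa [if_neg hil, zero_add, hite, add_zero] at h1
          · rw [hZ0 _ _ (Or.inl hi), mul_zero]
            exact Finset.sum_eq_zero fun v _ => mul_eq_zero_of_left (hA0 i v (Or.inl hi)) _
      · exact (hZ1 _ _ hA.root_mem (h.notMem q hq)).trans (hrow _)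
    have hy' : ∀ i, Z i (W (q + 1)) = 0 := fun i => congrFun hy i
    refine ⟨hy', fun hqm => ?_⟩
    have h1 := hSWrel q hq _ h.end_mem (Or.inl hqm)
    rwa [if_pos rfl, hy, Matrix.mulVec_zero, hite, hy', Pi.zero_apply, mul_zero, add_zero,
      add_zero] at h1
  have hSW : ∀ k q, q + k = m → (∀ i, Z i (W (q + 1)) = 0) ∧
      (q < m → X (W (m + 1)) (W (q + 1)) = 0) := by
    intro k
    induction k with
    | zero => exact fun q hq => hSWstep q (by omega) fun hqm => absurd hqm (by omega)
    | succ k ih => exact fun q hq => hSWstep q (by omega) fun _ => (ih (q + 1) (by omega)).1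
  have hU : ∀ i ≤ m, ∀ j ≤ m, X (W (i + 1)) (W (j + 1)) = 0 := by
    refine path_commutator_eq_zero hd (fun _ _ => hdiag _) (fun j hj => ?_)
      fun i hi j hj hij hij' => ?_
    · rcases hj.lt_or_eq with hjm | rfl
      · exact (hSW (m - j) j (by omega)).2 hjm
      · exact hdiag _
    · have h1 := hXY _ (hint i hi) _ (hint j hj) (fun e => hij (h.inj _ hi _ hj e))
        (fun hE => hE.elim (fun hF => h.notMem j hj (hA.edge_mem _ _ hF).1)
          fun hE => hij' (h.edge_new_new hi hj hE)) (fun hh => h.notMem i hi hh.1)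
      rw [Matrix.sub_apply, Matrix.mul_apply, Matrix.mul_apply, earMatrix_row_new_sum h hAS hi,
        earMatrix_col_new_sum h hAS hj, hYne _ _ (Or.inl (h.notMem i hi)),
        hYne _ _ (Or.inl (h.notMem i hi))] at h1
      have h2 : Y (W i) (W (j + 1)) = if i = 0 then 0 else X (W (i - 1 + 1)) (W (j + 1)) := by
        rcases i with _ | i
        · exact hY0 _ _ h.start_mem (h.notMem j hj)
        · exact hYne _ _ (Or.inl (h.notMem i (by omega)))
      rw [h2] at h1
      exact sub_eq_zero.1 h1
  -- the block `W × S`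
  have hWS : ∀ p ≤ m + 1, ∀ j ∈ S, X (W p) j = 0 := by
    intro p
    induction p with
    | zero => exact fun _ => hSS _ h.start_mem
    | succ p ih =>
      intro hp1
      have hp : p ≤ m := by omega
      have hrel : ∀ j ∈ S, j ≠ W 0 →
          ∑ v, A v j * S.indicator (X (W (p + 1))) v = d p * X (W (p + 1)) j := by
        intro j hj hj0
        have h1 := hXY _ (hint p hp) j (Or.inl hj) (h.ne_of_mem hp hj).symm
          (fun hE => hE.elim (fun hF => h.notMem p hp (hA.edge_mem _ _ hF).2)
            fun hE => hj0 (h.edge_old_new hp hj hE).2) (fun hh => hh.2 hj)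
        rw [Matrix.sub_apply, Matrix.mul_apply, earMatrix_row_new_sum h hAS hp,
          hYne _ _ (Or.inr hj), hYne _ _ (Or.inr hj), ih (by omega) j hj, add_zero] at h1
        refine Eq.trans ?_ (sub_eq_zero.1 h1).symm
        rw [Matrix.mul_apply]
        refine Finset.sum_congr rfl fun v _ => ?_
        rw [earMatrix_col_old h hj, if_neg (fun hh => hj0 hh.2), add_zero, mul_comm,
          hYne _ _ (Or.inl (h.notMem p hp))]
        by_cases hv : v ∈ S
        · rw [Set.indicator_of_mem hv]
        · rw [hA0 _ _ (Or.inl hv), mul_zero, mul_zero]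
      have hz : S.indicator (X (W (p + 1))) = 0 := by
        refine hobs' p _ ((Aᵀ *ᵥ S.indicator (X (W (p + 1)))) (W 0) - d p * X (W (p + 1)) (W 0))
          ?_ ?_
        · ext j
          simp only [Pi.add_apply, Pi.smul_apply, smul_eq_mul]
          by_cases hj0 : j = W 0
          · rw [hj0, Pi.single_eq_same, Set.indicator_of_mem h.start_mem]
            ring
          · rw [Pi.single_eq_of_ne hj0, mul_zero, add_zero]
            by_cases hj : j ∈ S
            · rw [Set.indicator_of_mem hj, ← hrel j hj hj0]
              rfl
            · rw [Set.indicator_of_notMem hj, mul_zero]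
              exact Finset.sum_eq_zero fun v _ => mul_eq_zero_of_left (hA0 v j (Or.inr hj)) _
        · rw [Set.indicator_of_mem hA.root_mem, hcol]
      intro j hj
      rw [← Set.indicator_of_mem hj (X (W (p + 1))), hz, Pi.zero_apply]
  ext i j
  by_contra hne
  obtain ⟨hi, hj, -⟩ := hX i j hne
  rcases hi with hi | ⟨p, hp, rfl⟩ <;> rcases hj with hj | ⟨q, hq, rfl⟩
  · exact hne (hSS i hi j hj)
  · exact hne ((hZ1 _ _ hi (h.notMem q hq)).symm.trans ((hSW (m - q) q (by omega)).1 i))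
  · exact hne (hWS (p + 1) (by omega) j hj)
  · exact hne (hU p hp q hq)

theorem commutator_apply (A X : Matrix V V ℂ) :
    (LinearMap.mulLeft ℂ A - LinearMap.mulRight ℂ A) X = A * X - X * A := rfl

theorem IsRigidOn.eventually_ear_eq_zero {S : Set V} {F : Set (V × V)} {r : V} {A : Matrix V V ℂ}
    (hA : IsRigidOn S F r A) {W : ℕ → V} {m : ℕ} (h : IsEarPath S W m) {d : ℕ → ℂ}
    (hd : Function.Injective d) (hobs : ∀ q, Observable A r (W (m + 2)) (d q))
    (hobs' : ∀ q, Observable Aᵀ r (W 0) (d q)) :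
    ∀ᶠ β : ℂ in Filter.cofinite, ∀ X : Matrix V V ℂ,
      (∀ i j, X i j ≠ 0 →
        i ∈ S ∪ earInterior W m ∧ j ∈ S ∪ earInterior W m ∧ i ≠ j ∧ i ≠ r ∧ j ≠ r) →
      (∀ i ∈ S ∪ earInterior W m, ∀ j ∈ S ∪ earInterior W m, i ≠ j →
        (j, i) ∉ F ∪ earEdges W m →
        ((earMatrix A W m d + β • Matrix.single (W (m + 2)) (W (m + 1)) (1 : ℂ)) * X -
          X * (earMatrix A W m d + β • Matrix.single (W (m + 2)) (W (m + 1)) (1 : ℂ))) i j = 0) →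
      X = 0 := by
  set T := S ∪ earInterior W m with hT
  set G := F ∪ earEdges W m with hG
  obtain ⟨N, hN⟩ : ∃ N, N = earMatrix A W m d := ⟨_, rfl⟩
  obtain ⟨B, hB⟩ : ∃ B, B = Matrix.single (W (m + 2)) (W (m + 1)) (1 : ℂ) := ⟨_, rfl⟩
  rw [← hN, ← hB]
  let SW : V → V → Prop := fun i j => i ∈ S ∧ j ∉ S
  let mS : Matrix V V ℂ →ₗ[ℂ] Matrix V V ℂ := entryMask SW
  let mC : Matrix V V ℂ →ₗ[ℂ] Matrix V V ℂ := entryMask fun i j => ¬ SW i j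
  let P : V → V → Prop := fun i j => (i ∈ T ∧ j ∈ T ∧ i ≠ j ∧ (j, i) ∉ G) ∧ SW i j
  let Q : V → V → Prop := fun i j => (i ∈ T ∧ j ∈ T ∧ i ≠ j ∧ (j, i) ∉ G) ∧ ¬ SW i j
  let adN := LinearMap.mulLeft ℂ N - LinearMap.mulRight ℂ N
  let adB := LinearMap.mulLeft ℂ B - LinearMap.mulRight ℂ B
  let f := entryMask Q ∘ₗ adN ∘ₗ mC + entryMask P ∘ₗ (adB ∘ₗ mC + adN ∘ₗ mS)
  let g := entryMask Q ∘ₗ (adB ∘ₗ mC + adN ∘ₗ mS)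
  have hfQ : ∀ X i j, Q i j → f X i j = adN (mC X) i j := fun X i j hq =>
    (congrArg₂ (· + ·) (entryMask_of_pos hq _)
      (entryMask_of_neg (P := P) (fun hp => hq.2 hp.2) _)).trans (add_zero _)
  have hfP : ∀ X i j, P i j → f X i j = (adB (mC X) + adN (mS X)) i j := fun X i j hp =>
    (congrArg₂ (· + ·) (entryMask_of_neg (P := Q) (fun hq => hq.2 hp.2) _)
      (entryMask_of_pos hp _)).trans (zero_add _)
  have hf0 : ∀ X i j, ¬ P i j → ¬ Q i j → f X i j = 0 := fun X i j hp hq =>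
    (congrArg₂ (· + ·) (entryMask_of_neg hq _) (entryMask_of_neg hp _)).trans (zero_add _)
  have hgQ : ∀ X i j, Q i j → g X i j = (adB (mC X) + adN (mS X)) i j := fun X i j hq =>
    entryMask_of_pos hq _
  have hg0 : ∀ X i j, ¬ Q i j → g X i j = 0 := fun X i j hq => entryMask_of_neg hq _
  let p : Submodule ℂ (Matrix V V ℂ) :=
    { carrier := {X | ∀ i j, ¬ (i ∈ T ∧ j ∈ T ∧ i ≠ j ∧ i ≠ r ∧ j ≠ r) → X i j = 0}
      add_mem' := fun {X Y} hX hY i j hij => by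
        rw [Matrix.add_apply, hX i j hij, hY i j hij, add_zero]
      zero_mem' := fun i j _ => rfl
      smul_mem' := fun c X hX i j hij => by
        rw [Matrix.smul_apply, hX i j hij, smul_zero] }
  have hf : ∀ X ∈ p, f X = 0 → X = 0 := by
    intro X hX hfX
    refine hA.ear_limit h hd hobs hobs' rfl rfl (fun i j hij => by_contra fun hh => hij (hX i j hh))
      (fun i hi j hj hij hE hsw => ?_) (fun i hi j hj hE => ?_)
    · rw [← hN]
      exact (hfQ X i j ⟨⟨hi, hj, hij, hE⟩, hsw⟩).symm.trans (congrFun (congrFun hfX i) j)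
    · obtain ⟨q, hq, rfl⟩ := hj
      rw [← hN, ← hB]
      refine (hfP X i _ ⟨⟨Or.inl hi, Or.inr ⟨q, hq, rfl⟩, h.ne_of_mem hq hi,
        fun hh => hh.elim (fun hF => h.notMem q hq (hA.edge_mem _ _ hF).1) hE⟩,
        hi, h.notMem q hq⟩).symm.trans (congrFun (congrFun hfX i) _)
  filter_upwards [eventually_injOn_add_smul p f g hf,
    (Set.finite_singleton (0 : ℂ)).compl_mem_cofinite] with β hβ hβ0 X hX hcomm
  have hβ0 : β ≠ 0 := hβ0
  have hmS : ∀ Y i j, SW i j → mS Y i j = Y i j := fun Y i j h0 => entryMask_of_pos h0 Y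
  have hmS' : ∀ Y i j, ¬ SW i j → mS Y i j = 0 := fun Y i j h0 => entryMask_of_neg h0 Y
  have hmC : ∀ Y i j, ¬ SW i j → mC Y i j = Y i j := fun Y i j h0 =>
    entryMask_of_pos (P := fun i j => ¬ SW i j) h0 Y
  have hmC' : ∀ Y i j, SW i j → mC Y i j = 0 := fun Y i j h0 =>
    entryMask_of_neg (P := fun i j => ¬ SW i j) (not_not.2 h0) Y
  have hsum : X = mC X + mS X := by
    ext i j
    rw [Matrix.add_apply]
    by_cases hsw : SW i j
    · rw [hmC' _ _ _ hsw, hmS _ _ _ hsw, zero_add]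
    · rw [hmC _ _ _ hsw, hmS' _ _ _ hsw, add_zero]
  have hCC : mC (mC X + β⁻¹ • mS X) = mC X := by
    ext i j
    by_cases hsw : SW i j
    · rw [hmC' _ _ _ hsw, hmC' _ _ _ hsw]
    · rw [hmC _ _ _ hsw, Matrix.add_apply, Matrix.smul_apply, hmS' _ _ _ hsw, smul_zero, add_zero]
  have hSC : mS (mC X + β⁻¹ • mS X) = β⁻¹ • mS X := by
    ext i j
    rw [Matrix.smul_apply]
    by_cases hsw : SW i j
    · rw [hmS _ _ _ hsw, Matrix.add_apply, Matrix.smul_apply, hmC' _ _ _ hsw, zero_add]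
    · rw [hmS' _ _ _ hsw, hmS' _ _ _ hsw, smul_zero]
  have hBS : adB (mS X) = 0 := by
    have h1 : B * mS X = 0 := by
      ext i j
      rw [hB, Matrix.zero_apply]
      by_cases hi : i = W (m + 2)
      · rw [hi, Matrix.single_mul_apply_same, one_mul,
          hmS' _ _ _ fun hh => h.notMem m le_rfl hh.1]
      · rw [Matrix.single_mul_apply_of_ne _ _ _ _ _ hi]
    have h2 : mS X * B = 0 := by
      ext i j
      rw [hB, Matrix.zero_apply]
      by_cases hj : j = W (m + 1)
      · rw [hj, Matrix.mul_single_apply_same, hmS' _ _ _ fun hh => hh.2 h.end_mem, zero_mul]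
      · rw [Matrix.mul_single_apply_of_ne _ _ _ _ _ hj]
    rw [commutator_apply, h1, h2, sub_zero]
  have hNC : ∀ i j, SW i j → adN (mC X) i j = 0 := by
    rintro i j ⟨hi, hj⟩
    have hA0 : ∀ u v, u ∉ S ∨ v ∉ S → A u v = 0 := fun u v huv => by
      by_contra hne
      have := hA.support u v hne
      tauto
    rw [commutator_apply, Matrix.sub_apply, Matrix.mul_apply, Matrix.mul_apply,
      Finset.sum_eq_zero, Finset.sum_eq_zero, sub_zero]
    · intro v _
      by_cases hv : v ∈ S
      · rw [hN, earMatrix_row_old h hv, hA0 _ _ (Or.inr hj), mul_zero]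
      · rw [hmC' _ _ _ ⟨hi, hv⟩, zero_mul]
    · intro v _
      by_cases hv : v ∈ S
      · rw [hmC' _ _ _ ⟨hv, hj⟩, mul_zero]
      · rw [hN, earMatrix_row_old h hi, hA0 _ _ (Or.inr hv), zero_mul]
  have hcomm' : ∀ i j, i ∈ T ∧ j ∈ T ∧ i ≠ j ∧ (j, i) ∉ G →
      adN (mC X) i j + adN (mS X) i j + β * adB (mC X) i j = 0 := by
    rintro i j ⟨hi, hj, hij, hE⟩
    have h1 : (N + β • B) * X - X * (N + β • B) =
        adN (mC X) + adN (mS X) + β • adB (mC X) := by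
      have : (N + β • B) * X - X * (N + β • B) = adN X + β • adB X := by
        simp only [adN, adB, commutator_apply, add_mul, mul_add, smul_mul_assoc, mul_smul_comm,
          smul_sub]
        abel
      rw [this]
      conv_lhs => rw [hsum]
      rw [map_add, map_add, hBS, add_zero]
    have h2 := hcomm i hi j hj hij hE
    rw [h1] at h2
    exact h2
  have hzero : mC X + β⁻¹ • mS X = 0 := by
    refine hβ _ (fun i j hij => ?_) ?_
    · have hXij : X i j = 0 := by_contra fun hh => hij (hX i j hh)
      rw [Matrix.add_apply, Matrix.smul_apply]
      by_cases hsw : SW i j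
      · rw [hmC' _ _ _ hsw, hmS _ _ _ hsw, hXij, smul_zero, add_zero]
      · rw [hmC _ _ _ hsw, hmS' _ _ _ hsw, hXij, smul_zero, add_zero]
    · ext i j
      rw [Matrix.add_apply, Matrix.smul_apply, Matrix.zero_apply, smul_eq_mul]
      by_cases hp : P i j
      · rw [hfP _ i j hp, hg0 _ i j (fun hq => hq.2 hp.2), hCC, hSC, map_smul, Matrix.add_apply,
          Matrix.smul_apply, smul_eq_mul]
        have h1 := hcomm' i j hp.1
        rw [hNC i j hp.2] at h1
        field_simp
        linear_combination h1
      by_cases hq : Q i j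
      · rw [hfQ _ i j hq, hgQ _ i j hq, hCC, hSC, map_smul, Matrix.add_apply,
          Matrix.smul_apply, smul_eq_mul]
        have h1 := hcomm' i j hq.1
        field_simp
        linear_combination h1
      · rw [hf0 _ i j hp hq, hg0 _ i j hq, mul_zero, add_zero]
  have hC0 : mC X = 0 := by rw [← hCC, hzero, map_zero]
  have hS0 : mS X = 0 := by
    have h1 : β⁻¹ • mS X = 0 := by rw [← hSC, hzero, map_zero]
    exact (smul_eq_zero.1 h1).resolve_left (inv_ne_zero hβ0)
  rw [hsum, hC0, hS0, add_zero]

theorem IsRigidOn.exists_ear {S : Set V} {F : Set (V × V)} {r : V} {A : Matrix V V ℂ}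
    (hA : IsRigidOn S F r A) {W : ℕ → V} {m : ℕ} (h : IsEarPath S W m) :
    ∃ A' : Matrix V V ℂ, IsRigidOn (S ∪ earInterior W m) (F ∪ earEdges W m) r A' := by
  have hAS : ∀ i j, A i j ≠ 0 → i ∈ S ∧ j ∈ S := fun i j hij =>
    ⟨(hA.support i j hij).1, (hA.support i j hij).2.1⟩
  obtain ⟨e₁, he₁⟩ := hA.obs _ h.end_mem
  obtain ⟨e₂, he₂⟩ := hA.obs_transpose _ h.start_mem
  have hinf := Filter.frequently_cofinite_iff_infinite.1
    (he₁.eventually.and he₂.eventually).frequently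
  let D := hinf.natEmbedding
  let d : ℕ → ℂ := fun q => D q
  have hd : Function.Injective d := Subtype.val_injective.comp D.injective
  have havoid : ∀ᶠ e : ℂ in Filter.cofinite, (∀ q ≤ m, d q ≠ e) ∧ e ≠ 0 := by
    have h1 : ((Finset.range (m + 1)).image d : Set ℂ)ᶜ ∈ Filter.cofinite :=
      (Finset.finite_toSet _).compl_mem_cofinite
    filter_upwards [h1, (Set.finite_singleton (0 : ℂ)).compl_mem_cofinite] with e he he0
    refine ⟨fun q hq hqe => he ?_, he0⟩
    simp only [Finset.coe_image, Set.mem_image]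
    exact ⟨q, by simpa using Nat.lt_succ_of_le hq, hqe⟩
  obtain ⟨N, hN⟩ : ∃ N, N = earMatrix A W m d := ⟨_, rfl⟩
  obtain ⟨B, hB⟩ : ∃ B, B = Matrix.single (W (m + 2)) (W (m + 1)) (1 : ℂ) := ⟨_, rfl⟩
  have hobs : ∀ᶠ β : ℂ in Filter.cofinite, ∀ v, v ∈ S → ∃ e, Observable (N + β • B) r v e := by
    refine Filter.eventually_all.2 fun v => ?_
    by_cases hv : v ∈ S
    · obtain ⟨e₀, he₀⟩ := hA.obs v hv
      obtain ⟨e, he, hed, hez⟩ := (he₀.eventually.and havoid).exists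
      have h1 := he.earMatrix h hAS hv hed hez
      rw [← hN] at h1
      exact (h1.eventually_add_smul B).mono fun β hβ _ => ⟨e, hβ⟩
    · exact Filter.Eventually.of_forall fun β hv' => absurd hv' hv
  have hobs' : ∀ᶠ β : ℂ in Filter.cofinite,
      ∀ v, v ∈ S → ∃ e, Observable (N + β • B)ᵀ r v e := by
    refine Filter.eventually_all.2 fun v => ?_
    by_cases hv : v ∈ S
    · obtain ⟨e₀, he₀⟩ := hA.obs_transpose v hv
      obtain ⟨e, he, hed, hez⟩ := (he₀.eventually.and havoid).exists
      have h1 := he.earMatrix_transpose h hAS hv hed hez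
      rw [← hN] at h1
      refine (h1.eventually_add_smul Bᵀ).mono fun β hβ _ => ⟨e, ?_⟩
      rwa [Matrix.transpose_add, Matrix.transpose_smul]
    · exact Filter.Eventually.of_forall fun β hv' => absurd hv' hv
  have hker := hA.eventually_ear_eq_zero h hd (fun q => (D q).2.1) (fun q => (D q).2.2)
  rw [← hN, ← hB] at hker
  obtain ⟨β, ⟨⟨hβ, hβobs⟩, hβobs'⟩, hβ0⟩ := (((hker.and hobs).and hobs').and
    (Set.finite_singleton (0 : ℂ)).compl_mem_cofinite).exists
  have hβ0 : β ≠ 0 := hβ0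
  have hroot : ∀ q ≤ m, W (q + 1) ≠ r := fun q hq => (h.ne_of_mem hq hA.root_mem).symm
  refine ⟨N + β • B, Or.inl hA.root_mem, ?_, ?_, hβ, ?_, ?_⟩
  · rintro u v (huv | ⟨q, hq, huv⟩)
    · exact ⟨Or.inl (hA.edge_mem u v huv).1, Or.inl (hA.edge_mem u v huv).2⟩
    · rw [Prod.mk.injEq] at huv
      rw [huv.1, huv.2]
      exact ⟨h.mem_union (by omega), h.mem_union (by omega)⟩
  · intro i j hij
    by_cases hNij : N i j = 0
    · by_cases hBij : W (m + 2) = i ∧ W (m + 1) = j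
      · obtain ⟨rfl, rfl⟩ := hBij
        exact ⟨h.mem_union le_rfl, h.mem_union (by omega), Or.inr (Or.inr ⟨m + 1, le_rfl, rfl⟩)⟩
      · refine absurd ?_ hij
        rw [Matrix.add_apply, hNij, Matrix.smul_apply, hB, Matrix.single_apply, if_neg hBij,
          smul_zero, add_zero]
    · rw [hN] at hNij
      rcases earMatrix_ne_zero hNij with h1 | ⟨h1, rfl⟩ | ⟨q, hq, rfl, rfl⟩
      · obtain ⟨hi, hj, hij⟩ := hA.support i j h1
        exact ⟨Or.inl hi, Or.inl hj, hij.imp_right Or.inl⟩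
      · exact ⟨Or.inr h1, Or.inr h1, Or.inl rfl⟩
      · exact ⟨h.mem_union (by omega), h.mem_union (by omega),
          Or.inr (Or.inr ⟨q, by omega, rfl⟩)⟩
  · have hW : ∀ k q, q + k = m + 1 → ∃ e, Observable (N + β • B) r (W (q + 1)) e := by
      intro k
      induction k with
      | zero =>
        intro q hq
        obtain rfl : q = m + 1 := by omega
        exact hβobs _ h.end_mem
      | succ k ih =>
        intro q hq
        have hqm : q ≤ m := by omega
        obtain ⟨e, he⟩ := ih (q + 1) (by omega)
        refine ⟨e, he.of_mulVec_single (a := d q) (c := if q < m then 1 else β) ?_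
          (hroot q hqm) ?_⟩
        · split_ifs
          · exact one_ne_zero
          · exact hβ0
        · ext i
          rw [Matrix.mulVec_single_one, Matrix.col_apply, Matrix.add_apply, Matrix.smul_apply, hN,
            hB, earMatrix_col_new h hAS hqm, Matrix.single_apply, h.eq_iff le_rfl hqm]
          by_cases hlt : q < m
          · simp [hlt, hlt.ne', Pi.single_apply]
          · obtain rfl : q = m := by omega
            simp [Pi.single_apply, eq_comm]
    rintro v (hv | ⟨q, hq, rfl⟩)
    · exact hβobs v hv
    · exact hW (m + 1 - q) q (by omega)
  · have hW : ∀ q ≤ m + 1, ∃ e, Observable (N + β • B)ᵀ r (W q) e := by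
      intro q
      induction q with
      | zero => exact fun _ => hβobs' _ h.start_mem
      | succ q ih =>
        intro hq
        have hqm : q ≤ m := by omega
        obtain ⟨e, he⟩ := ih (by omega)
        refine ⟨e, he.of_mulVec_single (a := d q) one_ne_zero (hroot q hqm) ?_⟩
        ext i
        have h1 : W (m + 2) ≠ W (q + 1) := h.ne_of_mem hqm h.end_mem
        rw [Matrix.mulVec_single_one, Matrix.col_apply, Matrix.transpose_apply, Matrix.add_apply,
          Matrix.smul_apply, hN, hB, earMatrix_row_new h hAS hqm, Matrix.single_apply]
        simp [h1, Pi.single_apply]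
    rintro v (hv | ⟨q, hq, rfl⟩)
    · exact hβobs' v hv
    · exact hW (q + 1) (by omega)

theorem isRigidOn_singleton (r : V) : IsRigidOn {r} ∅ r (0 : Matrix V V ℂ) := by
  have hobs : Observable (0 : Matrix V V ℂ) r r 1 := by
    intro y η hy hr
    have h1 : ∀ i, 0 = y i + η * (Pi.single r 1 : V → ℂ) i := fun i => by
      simpa using congrFun hy i
    have hη : η = 0 := by simpa [hr] using (h1 r).symm
    ext i
    simpa [hη] using (h1 i).symm
  refine ⟨rfl, fun _ _ h => h.elim, fun _ _ h => absurd rfl h, fun X hX _ => ?_, ?_, ?_⟩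
  · ext i j
    by_contra hne
    obtain ⟨hi, -, -, hir, -⟩ := hX i j hne
    exact hir hi
  · rintro v rfl
    exact ⟨1, hobs⟩
  · rintro v rfl
    exact ⟨1, by rwa [Matrix.transpose_zero]⟩

end Ear

section Sequence

theorem chainPairs_eq_earEdges (k l : V) {ws : List V} {m : ℕ} (hlen : ws.length = m + 1) :
    chainPairs (k :: ws ++ [l]) = earEdges (fun q => (k :: ws ++ [l]).getD q k) m := by
  ext e
  simp only [chainPairs, earEdges, Set.mem_ofPred_eq]
  rw [List.mem_iff_getElem]
  constructor
  · rintro ⟨q, hq, rfl⟩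
    have hq' : q < m + 2 := by simp at hq; omega
    refine ⟨q, by omega, ?_⟩
    rw [List.getElem_zip, List.getElem_tail, List.getD_eq_getElem, List.getD_eq_getElem]
  · rintro ⟨q, hq, rfl⟩
    refine ⟨q, by simp; omega, ?_⟩
    rw [List.getElem_zip, List.getElem_tail, List.getD_eq_getElem, List.getD_eq_getElem]

theorem getD_cons_append_succ (k l : V) {ws : List V} {q : ℕ} (hq : q < ws.length) :
    (k :: ws ++ [l]).getD (q + 1) k = ws[q] := by
  rw [List.getD_eq_getElem _ _ (by simp; omega)]
  simp [List.getElem_append_left, hq]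

theorem isEarPath_getD {S : Set V} {k l : V} {ws : List V} {m : ℕ} (hlen : ws.length = m + 1)
    (hk : k ∈ S) (hl : l ∈ S) (hnodup : ws.Nodup) (hws : ∀ w ∈ ws, w ∉ S) :
    IsEarPath S (fun q => (k :: ws ++ [l]).getD q k) m where
  start_mem := hk
  end_mem := by
    have h1 : (k :: ws ++ [l]).getD (m + 2) k = l := by
      rw [List.getD_eq_getElem _ _ (by simp; omega)]
      simp [hlen]
    simpa only [h1] using hl
  notMem q hq := by
    rw [getD_cons_append_succ k l (by omega)]
    exact hws _ (List.getElem_mem _)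
  inj p hp q hq hpq := by
    rw [getD_cons_append_succ k l (by omega), getD_cons_append_succ k l (by omega)] at hpq
    exact (hnodup.getElem_inj_iff).1 hpq

theorem earInterior_getD (k l : V) {ws : List V} {m : ℕ} (hlen : ws.length = m + 1) :
    earInterior (fun q => (k :: ws ++ [l]).getD q k) m = {x | x ∈ ws} := by
  ext v
  simp only [earInterior, Set.mem_ofPred_eq]
  rw [List.mem_iff_getElem]
  constructor
  · rintro ⟨q, hq, rfl⟩
    exact ⟨q, by omega, (getD_cons_append_succ k l (by omega)).symm⟩
  · rintro ⟨q, hq, rfl⟩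
    exact ⟨q, by omega, (getD_cons_append_succ k l hq).symm⟩

variable [Fintype V]

theorem IsRigidOn.exists_ear_list {S : Set V} {F : Set (V × V)} {r : V} {A : Matrix V V ℂ}
    (hA : IsRigidOn S F r A) {k l : V} {ws : List V} (hne : ws ≠ []) (hk : k ∈ S) (hl : l ∈ S)
    (hnodup : ws.Nodup) (hws : ∀ w ∈ ws, w ∉ S) :
    ∃ A' : Matrix V V ℂ,
      IsRigidOn (S ∪ {x | x ∈ ws}) (F ∪ chainPairs (k :: ws ++ [l])) r A' := by
  obtain ⟨m, hlen⟩ := Nat.exists_eq_succ_of_ne_zero (List.length_pos_iff.2 hne).ne'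
  rw [chainPairs_eq_earEdges k l hlen, ← earInterior_getD k l hlen]
  exact hA.exists_ear (isEarPath_getD hlen hk hl hnodup hws)

theorem HasNontrivialEarDecomp.exists_isRigidOn {E : V → V → Prop} {r : V}
    (h : HasNontrivialEarDecomp E r) :
    ∃ A : Matrix V V ℂ, IsRigidOn Set.univ {e : V × V | E e.1 e.2} r A := by
  obtain ⟨t, P, ⟨vs, hne, hnodup, -, hP, hP'⟩, hstep, hlast, hlast'⟩ := h
  have hall : ∀ i, ∃ A : Matrix V V ℂ, IsRigidOn (P i).1 (P i).2 r A := by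
    intro i
    induction i using Fin.induction with
    | zero =>
      rw [List.nodup_cons] at hnodup
      obtain ⟨A, hA⟩ := (isRigidOn_singleton r).exists_ear_list hne (k := r) (l := r) rfl rfl
        hnodup.2 fun w hw hwr => hnodup.1 (Set.mem_singleton_iff.1 hwr ▸ hw)
      refine ⟨A, ?_⟩
      convert hA using 1
      · ext x
        simp [hP]
      · rw [hP', Set.empty_union]
    | succ i ih =>
      obtain ⟨A, hA⟩ := ih
      obtain ⟨k, l, ws, hne, hnodup, hk, hl, hws, -, h1, h2⟩ := hstep i
      rw [h1, h2]
      exact hA.exists_ear_list hne hk hl hnodup hws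
  rw [← hlast, ← hlast']
  exact hall _

end Sequence

section Rank

variable [Fintype V]

theorem card_offDiag_ne (r : V) :
    Fintype.card {p : V × V // p.1 ≠ p.2 ∧ p.1 ≠ r ∧ p.2 ≠ r} =
      (Fintype.card V - 1) * (Fintype.card V - 2) := by
  have h1 : Finset.univ.filter (fun p : V × V => p.1 ≠ p.2 ∧ p.1 ≠ r ∧ p.2 ≠ r) =
      (Finset.univ.erase r).offDiag := by
    ext p
    simp only [Finset.mem_filter, Finset.mem_univ, true_and, Finset.mem_offDiag,
      Finset.mem_erase, and_true]
    tauto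
  rw [Fintype.card_subtype, h1, Finset.offDiag_card, Finset.card_erase_of_mem (Finset.mem_univ r),
    Finset.card_univ, ← Nat.mul_sub_one, Nat.sub_sub]

theorem Bmat_mulVec_apply (E : V → V → Prop) (r : V) (A : Matrix V V ℂ)
    (v : {p : V × V // p.1 ≠ p.2 ∧ p.1 ≠ r ∧ p.2 ≠ r} → ℂ)
    (kl : {p : V × V // p.1 ≠ p.2 ∧ ¬ E p.2 p.1}) (X : Matrix V V ℂ)
    (hX : ∀ p, X p.1.1 p.1.2 = v p)
    (hX' : ∀ i j, ¬ (i ≠ j ∧ i ≠ r ∧ j ≠ r) → X i j = 0) :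
    (Bmat E r A).mulVec v kl = (A * X - X * A) kl.1.1 kl.1.2 := by
  obtain ⟨⟨k, l⟩, hkl, hE⟩ := kl
  let f : V × V → ℂ := fun q => (if q.2 = l then A k q.1 * X q.1 q.2 else 0) -
    (if q.1 = k then X q.1 q.2 * A q.2 l else 0)
  have h1 : ∀ p, Bmat E r A ⟨(k, l), hkl, hE⟩ p * v p = f p := by
    rintro ⟨⟨i, j⟩, hp⟩
    rw [← hX]
    by_cases hi : i = k <;> by_cases hj : j = l
    · subst hi hj
      simp only [Bmat, f, and_self, if_true]
      ring
    · simp [Bmat, f, hi, hj, mul_comm]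
    · simp [Bmat, f, hi, hj]
    · simp [Bmat, f, hi, hj]
  have h2 : ∀ q : V × V, f q ≠ 0 → q.1 ≠ q.2 ∧ q.1 ≠ r ∧ q.2 ≠ r := fun q hq => by
    by_contra hne
    simp [f, hX' _ _ hne] at hq
  calc (Bmat E r A).mulVec v ⟨(k, l), hkl, hE⟩ = ∑ p : {p : V × V // _}, f p :=
        Finset.sum_congr rfl fun p _ => h1 p
    _ = ∑ q : V × V, f q := by
        rw [← Finset.sum_filter_of_ne fun q _ => h2 q]
        exact (Finset.sum_subtype _ (by simp) f).symm
    _ = (A * X - X * A) k l := by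
        simp [f, Fintype.sum_prod_type, Matrix.mul_apply, Finset.sum_sub_distrib,
          Finset.sum_ite_irrel]

theorem IsRigidOn.rank_Bmat {E : V → V → Prop} {r : V} {A : Matrix V V ℂ}
    (hA : IsRigidOn Set.univ {e : V × V | E e.1 e.2} r A) :
    A ∈ Theta E ∧ (Bmat E r A).rank = (Fintype.card V - 1) * (Fintype.card V - 2) := by
  refine ⟨fun i j hij hE => ?_, ?_⟩
  · by_contra hne
    exact (hA.support i j hne).2.2.elim hij hE
  · rw [← card_offDiag_ne r, Matrix.rank, LinearMap.finrank_range_of_inj, Module.finrank_pi]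
    refine (injective_iff_map_eq_zero _).2 fun v hv => ?_
    let X : Matrix V V ℂ := fun i j => if h : i ≠ j ∧ i ≠ r ∧ j ≠ r then v ⟨(i, j), h⟩ else 0
    have hX : ∀ p, X p.1.1 p.1.2 = v p := fun p => dif_pos p.2
    have hX' : ∀ i j, ¬ (i ≠ j ∧ i ≠ r ∧ j ≠ r) → X i j = 0 := fun i j h => dif_neg h
    have hX0 : X = 0 := by
      refine hA.eq_zero X (fun i j hij => ?_) fun i _ j _ hij hE => ?_
      · exact ⟨trivial, trivial, by_contra fun h => hij (hX' i j h)⟩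
      · rw [← Bmat_mulVec_apply E r A v ⟨(i, j), hij, hE⟩ X hX hX']
        exact congrFun hv _
    ext p
    rw [← hX p, hX0]
    rfl

end Rank

/-- If a directed simple graph `G` on `Fin n` (`n ≥ 2`)
admits a nontrivial ear decomposition rooted at the distinguished vertex `0`,
then there exists `A ∈ Θ_G` such that `B_G(A)` has full column rank
`(n-1)(n-2)`. -/
theorem nontrivialEarDecomp_fullB (n : ℕ) (hn : 2 ≤ n)
    (E : Fin n → Fin n → Prop) (hirr : ∀ u, ¬ E u u)
    (h : HasNontrivialEarDecomp E (⟨0, by omega⟩ : Fin n)) :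
    ∃ A ∈ Theta E,
      (Bmat E (⟨0, by omega⟩ : Fin n) A).rank = (n - 1) * (n - 2) := by
  obtain ⟨A, hA⟩ := h.exists_isRigidOn
  obtain ⟨hΘ, hrank⟩ := hA.rank_Bmat
  rw [Fintype.card_fin] at hrank
  exact ⟨A, hΘ, by convert hrank⟩
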